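/- Let φ be a 3-CNF formula with m ≥ 2 clauses over n ≥ 4 variables, each clause containing exactly three literals on three pairwise distinct variables, and every variable occurring (in some polarity) in at least one clause. Let d ≥ 4 be even and let G' be obtained from G(φ) and Q_{(d−2)/2} by identifying the vertex c_0 of Q_{(d−2)/2} with the special vertex a of G(φ). Then G' has diameter exactly d, and G(φ) admits a strong conflict-free vertex-connection 3-coloring if and only if G' does. -/

import Mathlib

open SimpleGraph

/-- Vertices of the graph `G(φ)`: four special vertices `a, b, c, d`, a literal vertex
`lit x s` for each variable `x` and polarity `s` (`lit x true = v_x`,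
`lit x false = v_x̄`), and for each clause `j` the triangle `cl j, cla j, clb j`. -/
inductive GV (n m : ℕ) where
  | a | b | c | d
  | lit : Fin n → Bool → GV n m
  | cl : Fin m → GV n m
  | cla : Fin m → GV n m
  | clb : Fin m → GV n m
deriving DecidableEq

/-- The graph `G(φ)` built from a 3-CNF formula `φ` whose `j`-th clause consists of the
three literals `Cl j 0, Cl j 1, Cl j 2` (a literal being a pair of a variable and a
polarity). -/
def Gphi {n m : ℕ} (Cl : Fin m → Fin 3 → Fin n × Bool) : SimpleGraph (GV n m) :=
  SimpleGraph.fromRel (fun x y =>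
    match x, y with
    | .a, .b => True
    | .a, .c => True
    | .a, .d => True
    | .b, .d => True
    | .c, .d => True
    | .lit x s, .lit x' s' => x = x' ∧ s ≠ s'
    | .a, .lit _ _ => True
    | .cl j, .cla j' => j = j'
    | .cl j, .clb j' => j = j'
    | .cla j, .clb j' => j = j'
    | .cl j, .lit x s => ∃ t, Cl j t = (x, s)
    | .c, .cl _ => True
    | .a, .cla _ => True
    | .b, .clb _ => True
    | _, _ => False)

/-- `f` is a strong conflict-free vertex-connection coloring of `G`: any two distinct
vertices are joined by a shortest path on which some color occurs exactly once. -/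
def IsSCFVC {V α : Type*} [DecidableEq α] (G : SimpleGraph V) (f : V → α) : Prop :=
  ∀ u v : V, u ≠ v → ∃ p : G.Walk u v, p.length = G.dist u v ∧
    ∃ c : α, (p.support.map f).count c = 1

/-- The vertices of `Q N` other than `c_0`: `A i`, `B i` are `a_{i+1}`, `b_{i+1}` and
`C i` is `c_{i+1}`, for `i : Fin N`. -/
inductive QV' (N : ℕ) where
  | A : Fin N → QV' N
  | B : Fin N → QV' N
  | C : Fin N → QV' N
deriving DecidableEq

/-- The graph obtained from `G(φ)` and `Q N` by identifying the vertex `c_0` of `Q N`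
with the special vertex `a` of `G(φ)`. -/
def GphiQ {n m : ℕ} (Cl : Fin m → Fin 3 → Fin n × Bool) (N : ℕ) :
    SimpleGraph (GV n m ⊕ QV' N) :=
  SimpleGraph.fromRel (fun x y =>
    match x, y with
    | .inl u, .inl v => (Gphi Cl).Adj u v
    | .inr (.A i), .inr (.B j) => i.val = j.val
    | .inr (.A i), .inr (.C j) => j.val + 1 = i.val ∨ j.val = i.val
    | .inr (.B i), .inr (.C j) => j.val + 1 = i.val ∨ j.val = i.val
    | .inl .a, .inr (.A i) => i.val = 0
    | .inl .a, .inr (.B i) => i.val = 0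
    | _, _ => False)


section G
variable {n m : ℕ} (Cl : Fin m → Fin 3 → Fin n × Bool)

theorem adj_a (x : GV n m) : (Gphi Cl).Adj x .a ↔
    x = .b ∨ x = .c ∨ x = .d ∨ (∃ y s, x = .lit y s) ∨ ∃ j, x = .cla j := by
  cases x <;> simp [Gphi]

theorem adj_lit (x : GV n m) (y s) : (Gphi Cl).Adj x (.lit y s) ↔
    x = .a ∨ x = .lit y (!s) ∨ ∃ j, x = .cl j ∧ ∃ t, Cl j t = (y, s) := by
  cases x <;> simp [Gphi]
  rename_i z s'
  cases s <;> cases s' <;> simp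
  all_goals grind

theorem adj_cl (x : GV n m) (j) : (Gphi Cl).Adj (.cl j) x ↔
    x = .c ∨ x = .cla j ∨ x = .clb j ∨ ∃ t, x = .lit (Cl j t).1 (Cl j t).2 := by
  cases x <;> simp [Gphi] <;> grind

theorem adj_clb (x : GV n m) (j) : (Gphi Cl).Adj (.clb j) x ↔
    x = .cl j ∨ x = .cla j ∨ x = .b := by
  cases x <;> simp [Gphi]

theorem proper {V : Type*} {G : SimpleGraph V} {f : V → Fin 3} (hf : IsSCFVC G f) {u v : V}
    (h : G.Adj u v) : f u ≠ f v := by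
  intro e
  obtain ⟨p, hp, c, hc⟩ := hf u v h.ne
  rw [SimpleGraph.dist_eq_one_iff_adj.mpr h] at hp
  cases p with
  | nil => simp at hp
  | cons h1 p =>
    cases p with
    | nil => simp [e] at hc; grind
    | cons h2 p => simp at hp

/-- A vertex pair with a walk of length three: the good walk has length at most three. -/
theorem three {V : Type*} {G : SimpleGraph V} {f : V → Fin 3} (hf : IsSCFVC G f) {u v w z : V}
    (hne : u ≠ v) (h1 : G.Adj u w) (h2 : G.Adj w z) (h3 : G.Adj z v) :
    G.Adj u v ∨ (∃ x, G.Adj u x ∧ G.Adj x v) ∨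
    ∃ x y, G.Adj u x ∧ G.Adj x y ∧ G.Adj y v ∧ ¬ (f x = f v ∧ f y = f u) := by
  obtain ⟨p, hp, c, hc⟩ := hf u v hne
  have hl : p.length ≤ 3 := by
    rw [hp]; exact SimpleGraph.dist_le (Walk.cons h1 (Walk.cons h2 (Walk.cons h3 Walk.nil)))
  cases p with
  | nil => exact absurd rfl hne
  | cons a1 p =>
    cases p with
    | nil => exact Or.inl a1
    | cons a2 p =>
      cases p with
      | nil => exact Or.inr (Or.inl ⟨_, a1, a2⟩)
      | cons a3 p =>
        cases p with
        | nil =>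
          refine Or.inr (Or.inr ⟨_, _, a1, a2, a3, ?_⟩)
          rintro ⟨e1, e2⟩
          simp [e1, e2, List.count_cons] at hc
          split_ifs at hc <;> omega
        | cons a4 p => simp at hl; omega

theorem outvar (hn : 4 ≤ n) (j : Fin m) : ∃ y : Fin n, ∀ t, (Cl j t).1 ≠ y := by
  by_contra! h
  have : Function.Surjective (fun t : Fin 3 => (Cl j t).1) := h
  have := Fintype.card_le_of_surjective _ this
  simp at this; omega

theorem normal (hn : 4 ≤ n) {f : GV n m → Fin 3} (hf : IsSCFVC (Gphi Cl) f)
    (ha : f .a = 0) (hb : f .b = 1) (hd : f .d = 2) :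
    f .c = 1 ∧ (∀ j, f (.cla j) = 1 ∧ f (.clb j) = 2 ∧ f (.cl j) = 0) ∧
    (∀ j, ∃ t, f (.lit (Cl j t).1 (Cl j t).2) = 2) := by
  have pr : ∀ {u v}, (Gphi Cl).Adj u v → f u ≠ f v := fun h => proper hf h
  have hc : f .c = 1 := by
    have h1 : f .c ≠ f .a := pr (by simp [Gphi])
    have h2 : f .c ≠ f .d := pr (by simp [Gphi])
    omega
  have hlit : ∀ y, ∃ s, f (.lit y s) = 1 := by
    intro y
    have h1 : f (.lit y true) ≠ f .a := pr (by simp [Gphi])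
    have h2 : f (.lit y false) ≠ f .a := pr (by simp [Gphi])
    have h3 : f (.lit y true) ≠ f (.lit y false) := pr (by simp [Gphi])
    by_cases h : f (.lit y true) = 1
    · exact ⟨_, h⟩
    · exact ⟨false, by omega⟩
  have hcl : ∀ j, f (.cla j) = 1 ∧ f (.clb j) = 2 ∧ f (.cl j) = 0 := by
    intro j
    have h1 : f (.cla j) ≠ f .a := pr (by simp [Gphi])
    have h2 : f (.clb j) ≠ f .b := pr (by simp [Gphi])
    have h3 : f (.cl j) ≠ f .c := pr (by simp [Gphi])
    have h4 : f (.cl j) ≠ f (.cla j) := pr (by simp [Gphi])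
    have h5 : f (.cl j) ≠ f (.clb j) := pr (by simp [Gphi])
    have h6 : f (.cla j) ≠ f (.clb j) := pr (by simp [Gphi])
    have h7 : f (.clb j) ≠ 0 := by
      intro h0
      obtain ⟨y, hy⟩ := outvar Cl hn j
      obtain ⟨s, hs⟩ := hlit y
      rcases three hf (u := .clb j) (v := .lit y s) (w := .b) (z := .a) (by simp)
        (by simp [Gphi]) (by simp [Gphi]) (by simp [Gphi]) with h | ⟨x, hx, hx'⟩ |
          ⟨x, z, hx, hxz, hz, hne⟩
      · simp [Gphi] at h
      · rw [adj_clb] at hx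
        rcases hx with rfl | rfl | rfl
        · rw [adj_cl] at hx'
          simp at hx'; grind
        · simp [Gphi] at hx'
        · simp [Gphi] at hx'
      · rw [adj_clb] at hx
        rcases hx with rfl | rfl | rfl
        · rw [adj_cl] at hxz
          rcases hxz with rfl | rfl | rfl | ⟨t, rfl⟩
          · simp [Gphi] at hz
          · simp [Gphi] at hz
          · simp [Gphi] at hz
          · simp [Gphi] at hz; grind
        · rw [adj_lit] at hz
          rcases hz with rfl | rfl | ⟨k, rfl, t, ht⟩
          · apply hne; omega
          · simp [Gphi] at hxz
          · simp [Gphi] at hxz; subst hxz; have := hy t; simp [ht] at this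
        · rw [adj_lit] at hz
          rcases hz with rfl | rfl | ⟨k, rfl, t, ht⟩
          · apply hne; omega
          · simp [Gphi] at hxz
          · simp [Gphi] at hxz
    omega
  refine ⟨hc, hcl, ?_⟩
  intro j
  by_contra! hno
  obtain ⟨y, hy⟩ := outvar Cl hn j
  obtain ⟨s, hs⟩ := hlit y
  have key : ∀ x, (Gphi Cl).Adj (.cl j) x → x = .clb j ∨ f x = 1 := by
    intro x hx
    rw [adj_cl] at hx
    rcases hx with rfl | rfl | rfl | ⟨t, rfl⟩
    · exact Or.inr hc
    · exact Or.inr (hcl j).1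
    · exact Or.inl rfl
    · have h1 : f (.lit (Cl j t).1 (Cl j t).2) ≠ f .a := pr (by simp [Gphi])
      have := hno t
      right; omega
  rcases three hf (u := .cl j) (v := .lit y s) (w := .c) (z := .a) (by simp)
    (by simp [Gphi]) (by simp [Gphi]) (by simp [Gphi]) with h | ⟨x, hx, hx'⟩ |
      ⟨x, z, hx, hxz, hz, hne⟩
  · rw [adj_cl] at h; simp at h; grind
  · rw [adj_cl] at hx
    rcases hx with rfl | rfl | rfl | ⟨t, rfl⟩
    · simp [Gphi] at hx'
    · simp [Gphi] at hx'
    · simp [Gphi] at hx'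
    · simp [Gphi] at hx'; grind
  · rw [adj_lit] at hz
    have hzz : z ≠ .lit y !s := by
      rintro rfl
      rw [adj_cl] at hx
      rcases hx with rfl | rfl | rfl | ⟨t, rfl⟩
      · simp [Gphi] at hxz
      · simp [Gphi] at hxz
      · simp [Gphi] at hxz
      · simp [Gphi] at hxz; grind
    rcases key x hx with rfl | h1
    · rw [adj_clb] at hxz
      rcases hz with rfl | rfl | ⟨k, rfl, t, ht⟩
      · simp at hxz
      · exact hzz rfl
      · simp at hxz; subst hxz; have := hy t; simp [ht] at this
    · rcases hz with rfl | rfl | ⟨k, rfl, t, ht⟩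
      · exact hne ⟨by omega, by rw [ha, (hcl j).2.2]⟩
      · exact hzz rfl
      · exact hne ⟨by omega, by rw [(hcl k).2.2, (hcl j).2.2]⟩

end G

section Q
variable {n m : ℕ} (Cl : Fin m → Fin 3 → Fin n × Bool) (N : ℕ)

/-- Distance to the special vertex `a` in `G(φ)`. -/
def lev : GV n m → ℤ
  | .a => 0
  | .b => 1
  | .c => 1
  | .d => 1
  | .lit _ _ => 1
  | .cl _ => 2
  | .cla _ => 1
  | .clb _ => 2

/-- A signed distance to the cut vertex. -/
def pot : GV n m ⊕ QV' N → ℤ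
  | .inl u => - lev u
  | .inr (.A i) => 2 * i.val + 1
  | .inr (.B i) => 2 * i.val + 1
  | .inr (.C i) => 2 * i.val + 2

theorem lev_adj {x y : GV n m} (h : (Gphi Cl).Adj x y) : lev x - lev y ≤ 1 := by
  cases x <;> cases y <;> simp [lev] <;> simp [Gphi] at h

theorem inl_adj {x y : GV n m} :
    (GphiQ Cl N).Adj (.inl x) (.inl y) ↔ (Gphi Cl).Adj x y := by
  simp only [GphiQ, SimpleGraph.fromRel_adj, (Gphi Cl).adj_comm y x, or_self]
  exact ⟨fun h => h.2, fun h => ⟨by simpa using h.ne, h⟩⟩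

theorem inl_inr_adj {x : GV n m} {y : QV' N} (h : (GphiQ Cl N).Adj (.inl x) (.inr y)) :
    x = .a ∧ pot N (.inr y : GV n m ⊕ QV' N) = 1 := by
  cases x <;> cases y <;> simp [GphiQ] at h <;> simp [pot, h]

theorem pot_adj {x y : GV n m ⊕ QV' N} (h : (GphiQ Cl N).Adj x y) :
    pot N y - pot N x ≤ 1 := by
  rcases x with x | x <;> rcases y with y | y
  · have := lev_adj Cl ((inl_adj Cl N).1 h)
    simp only [pot]; omega
  · obtain ⟨rfl, h2⟩ := inl_inr_adj Cl N h
    rw [h2]; simp [pot, lev]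
  · obtain ⟨rfl, h2⟩ := inl_inr_adj Cl N h.symm
    rw [h2]; simp [pot, lev]
  · cases x <;> cases y <;> simp [GphiQ, pot] at h ⊢ <;> omega

theorem pot_walk {x y : GV n m ⊕ QV' N} (p : (GphiQ Cl N).Walk x y) :
    pot N y - pot N x ≤ p.length := by
  induction p with
  | nil => simp
  | cons h p ih => have := pot_adj Cl N h; simp; omega

theorem short {x y : GV n m ⊕ QV' N} (p : (GphiQ Cl N).Walk x y)
    (h : (p.length : ℤ) = pot N y - pot N x) : p.length = (GphiQ Cl N).dist x y := by
  obtain ⟨q, hq⟩ := SimpleGraph.Reachable.exists_walk_length_eq_dist ⟨p⟩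
  have := pot_walk Cl N q
  have := SimpleGraph.dist_le p
  omega

/-- There is a walk of length `l` from `x` to `y` with the given color counts (the first
vertex is not counted). -/
def R (F : GV n m ⊕ QV' N → Fin 3) (x y : GV n m ⊕ QV' N) (l n0 n1 n2 : ℕ) : Prop :=
  ∃ p : (GphiQ Cl N).Walk x y, p.length = l ∧ (p.support.tail.map F).count 0 = n0 ∧
    (p.support.tail.map F).count 1 = n1 ∧ (p.support.tail.map F).count 2 = n2

variable {Cl N} {F : GV n m ⊕ QV' N → Fin 3}

theorem R.trans {x y z : GV n m ⊕ QV' N} {l n0 n1 n2 k m0 m1 m2 : ℕ}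
    (h : R Cl N F x y l n0 n1 n2) (h' : R Cl N F y z k m0 m1 m2) :
    R Cl N F x z (l + k) (n0 + m0) (n1 + m1) (n2 + m2) := by
  obtain ⟨p, a1, a2, a3, a4⟩ := h
  obtain ⟨q, b1, b2, b3, b4⟩ := h'
  refine ⟨p.append q, ?_, ?_, ?_, ?_⟩ <;>
  simp only [SimpleGraph.Walk.tail_support_append, SimpleGraph.Walk.length_append,
    List.map_append, List.count_append, *]

theorem R.zero (x : GV n m ⊕ QV' N) : R Cl N F x x 0 0 0 0 := ⟨Walk.nil, by simp⟩

theorem R.e0 {x y : GV n m ⊕ QV' N} (h : (GphiQ Cl N).Adj x y) (hy : F y = 0) :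
    R Cl N F x y 1 1 0 0 := ⟨Walk.cons h Walk.nil, by simp [hy]⟩

theorem R.e1 {x y : GV n m ⊕ QV' N} (h : (GphiQ Cl N).Adj x y) (hy : F y = 1) :
    R Cl N F x y 1 0 1 0 := ⟨Walk.cons h Walk.nil, by simp [hy]⟩

theorem R.e2 {x y : GV n m ⊕ QV' N} (h : (GphiQ Cl N).Adj x y) (hy : F y = 2) :
    R Cl N F x y 1 0 0 1 := ⟨Walk.cons h Walk.nil, by simp [hy]⟩

/-- The conclusion for one pair. -/
def Good (Cl : Fin m → Fin 3 → Fin n × Bool) (N : ℕ) (F : GV n m ⊕ QV' N → Fin 3)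
    (x y : GV n m ⊕ QV' N) : Prop :=
  ∃ p : (GphiQ Cl N).Walk x y, p.length = (GphiQ Cl N).dist x y ∧
    ∃ c : Fin 3, (p.support.map F).count c = 1

theorem Good.symm {x y : GV n m ⊕ QV' N} (h : Good Cl N F x y) : Good Cl N F y x := by
  obtain ⟨p, hp, c, hc⟩ := h
  refine ⟨p.reverse, by rw [SimpleGraph.Walk.length_reverse, hp, SimpleGraph.dist_comm], c, ?_⟩
  simpa [SimpleGraph.Walk.support_reverse] using hc

theorem R.good {x y : GV n m ⊕ QV' N} {l n0 n1 n2 : ℕ} (h : R Cl N F x y l n0 n1 n2)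
    (hl : (l : ℤ) = pot N y - pot N x)
    (hc : (n0 + (if F x = 0 then 1 else 0) = 1) ∨ (n1 + (if F x = 1 then 1 else 0) = 1) ∨
      (n2 + (if F x = 2 then 1 else 0) = 1)) : Good Cl N F x y := by
  obtain ⟨p, a1, a2, a3, a4⟩ := h
  refine ⟨p, short Cl N p (by omega), ?_⟩
  rw [← SimpleGraph.Walk.cons_tail_support p]
  simp only [List.map_cons, List.count_cons, beq_iff_eq]
  rcases hc with hc | hc | hc
  · exact ⟨0, by rw [a2]; exact hc⟩
  · exact ⟨1, by rw [a3]; exact hc⟩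
  · exact ⟨2, by rw [a4]; exact hc⟩

/-- The vertices `c_0, …, c_N`. -/
def cc (n m : ℕ) {N : ℕ} : (i : ℕ) → i ≤ N → GV n m ⊕ QV' N
  | 0, _ => .inl .a
  | i + 1, h => .inr (.C ⟨i, h⟩)

/-- Extended coloring. -/
def ext (N : ℕ) (f : GV n m → Fin 3) : GV n m ⊕ QV' N → Fin 3
  | .inl u => f u
  | .inr (.A _) => 1
  | .inr (.B _) => 2
  | .inr (.C _) => 0

variable {f : GV n m → Fin 3}

theorem adj_cA {i : ℕ} (h : i < N) : (GphiQ Cl N).Adj (cc n m i h.le) (.inr (.A ⟨i, h⟩)) := by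
  cases i <;> simp [cc, GphiQ]
theorem adj_cB {i : ℕ} (h : i < N) : (GphiQ Cl N).Adj (cc n m i h.le) (.inr (.B ⟨i, h⟩)) := by
  cases i <;> simp [cc, GphiQ]
theorem adj_Ac {i : ℕ} (h : i < N) : (GphiQ Cl N).Adj (.inr (.A ⟨i, h⟩)) (cc n m (i + 1) h) := by
  simp [cc, GphiQ]
theorem adj_Bc {i : ℕ} (h : i < N) : (GphiQ Cl N).Adj (.inr (.B ⟨i, h⟩)) (cc n m (i + 1) h) := by
  simp [cc, GphiQ]

theorem ext_cc (ha : f .a = 0) (i : ℕ) (h : i ≤ N) : ext N f (cc n m i h) = 0 := by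
  cases i <;> simp [cc, ext, ha]

theorem pot_cc (i : ℕ) (h : i ≤ N) : pot N (cc n m i h) = 2 * i := by
  cases i <;> simp [cc, pot, lev]; ring

theorem potA (i : ℕ) (h : i < N) :
    pot N (.inr (.A ⟨i, h⟩) : GV n m ⊕ QV' N) = 2 * i + 1 := rfl
theorem potB (i : ℕ) (h : i < N) :
    pot N (.inr (.B ⟨i, h⟩) : GV n m ⊕ QV' N) = 2 * i + 1 := rfl

theorem ladder (ha : f .a = 0) (i p q k : ℕ) (hk : k = i + (p + q)) (h : k ≤ N) :
    R Cl N (ext N f) (cc n m i (by omega)) (cc n m k h) (2 * (p + q)) (p + q) p q := by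
  induction k generalizing p q with
  | zero =>
    obtain rfl : i = 0 := by omega
    obtain rfl : p = 0 := by omega
    obtain rfl : q = 0 := by omega
    exact R.zero _
  | succ k ih =>
    rcases p with _ | p
    · rcases q with _ | q
      · obtain rfl : i = k + 1 := by omega
        exact R.zero _
      · have := ((ih 0 q (by omega) (by omega)).trans
          (R.e2 (adj_cB (show k < N by omega)) rfl)).trans (R.e0 (adj_Bc _) (ext_cc ha _ _))
        convert this using 1 <;> omega
    · have := ((ih p q (by omega) (by omega)).trans
          (R.e1 (adj_cA (show k < N by omega)) rfl)).trans (R.e0 (adj_Ac _) (ext_cc ha _ _))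
      convert this using 1 <;> omega

theorem toA (ha : f .a = 0) (i p q k : ℕ) (hk : k = i + (p + q)) (h : k < N) :
    R Cl N (ext N f) (cc n m i (by omega)) (.inr (.A ⟨k, h⟩)) (2 * (p + q) + 1) (p + q)
      (p + 1) q := (ladder ha i p q k hk h.le).trans (R.e1 (adj_cA h) rfl)

theorem toB (ha : f .a = 0) (i p q k : ℕ) (hk : k = i + (p + q)) (h : k < N) :
    R Cl N (ext N f) (cc n m i (by omega)) (.inr (.B ⟨k, h⟩)) (2 * (p + q) + 1) (p + q)
      p (q + 1) := (ladder ha i p q k hk h.le).trans (R.e2 (adj_cB h) rfl)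

theorem good_adj {x y : GV n m ⊕ QV' N} (h : (GphiQ Cl N).Adj x y) (hc : F x ≠ F y) :
    Good Cl N F x y := by
  refine ⟨Walk.cons h Walk.nil, ?_, F x, ?_⟩
  · rw [SimpleGraph.dist_eq_one_iff_adj.mpr h]; rfl
  · simp [hc.symm]

theorem cC (i : Fin N) : (Sum.inr (.C i) : GV n m ⊕ QV' N) = cc n m (i.val + 1) i.2 := rfl

/-- From a prefix reaching `c_i` to every later vertex: a generic statement. -/
theorem fromTo (ha : f .a = 0) (x : GV n m ⊕ QV' N) (i : ℕ) (hi : i ≤ N) (l n0 n1 n2 : ℕ)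
    (hx : R Cl N (ext N f) x (cc n m i hi) l n0 n1 n2)
    (hl : (l : ℤ) = pot N (cc n m i hi) - pot N x) (p q k : ℕ) (hk : k = i + (p + q)) :
    (∀ h : k ≤ N, ((n0 + (p + q) + (if ext N f x = 0 then 1 else 0) = 1) ∨
      (n1 + p + (if ext N f x = 1 then 1 else 0) = 1) ∨
      (n2 + q + (if ext N f x = 2 then 1 else 0) = 1)) →
      Good Cl N (ext N f) x (cc n m k h)) ∧
    (∀ h : k < N, ((n0 + (p + q) + (if ext N f x = 0 then 1 else 0) = 1) ∨
      (n1 + (p + 1) + (if ext N f x = 1 then 1 else 0) = 1) ∨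
      (n2 + q + (if ext N f x = 2 then 1 else 0) = 1)) →
      Good Cl N (ext N f) x (.inr (.A ⟨k, h⟩))) ∧
    (∀ h : k < N, ((n0 + (p + q) + (if ext N f x = 0 then 1 else 0) = 1) ∨
      (n1 + p + (if ext N f x = 1 then 1 else 0) = 1) ∨
      (n2 + (q + 1) + (if ext N f x = 2 then 1 else 0) = 1)) →
      Good Cl N (ext N f) x (.inr (.B ⟨k, h⟩))) := by
  rw [pot_cc] at hl
  refine ⟨fun h hc => ?_, fun h hc => ?_, fun h hc => ?_⟩
  · exact (hx.trans (ladder ha i p q k hk h)).good (by rw [pot_cc]; push_cast; omega) hc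
  · exact (hx.trans (toA ha i p q k hk h)).good (by rw [potA]; push_cast; omega) hc
  · exact (hx.trans (toB ha i p q k hk h)).good (by rw [potB]; push_cast; omega) hc

end Q

section Main
variable {n m : ℕ} {Cl : Fin m → Fin 3 → Fin n × Bool} {N : ℕ} {f : GV n m → Fin 3}

/-- `x` is well connected to everything beyond `c_i`. -/
def Later (Cl : Fin m → Fin 3 → Fin n × Bool) (N : ℕ) (f : GV n m → Fin 3)
    (x : GV n m ⊕ QV' N) (i : ℕ) : Prop :=
  (∀ k (h : k ≤ N), i < k → Good Cl N (ext N f) x (cc n m k h)) ∧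
  (∀ k (h : k < N), i ≤ k → Good Cl N (ext N f) x (.inr (.A ⟨k, h⟩))) ∧
  (∀ k (h : k < N), i ≤ k → Good Cl N (ext N f) x (.inr (.B ⟨k, h⟩)))

theorem later0 (ha : f .a = 0) (i : ℕ) (hi : i ≤ N) : Later Cl N f (cc n m i hi) i := by
  have key := fromTo (Cl := Cl) ha (cc n m i hi) i hi 0 0 0 0 (R.zero _) (by simp)
  have hx := ext_cc (n := n) (m := m) (f := f) ha i hi
  refine ⟨fun k h hk => ?_, fun k h hk => ?_, fun k h hk => ?_⟩
  · exact (key 1 (k - i - 1) k (by omega)).1 h (by simp [hx])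
  · exact (key 0 (k - i) k (by omega)).2.1 h (by simp [hx])
  · exact (key (k - i) 0 k (by omega)).2.2 h (by simp [hx])

theorem later1 (ha : f .a = 0) (x : GV n m ⊕ QV' N) (i : ℕ) (hi : i ≤ N)
    (h : (GphiQ Cl N).Adj x (cc n m i hi)) (hp : 1 = pot N (cc n m i hi) - pot N x)
    (hx : ext N f x = 1) : Later Cl N f x i := by
  have key := fromTo (Cl := Cl) ha x i hi 1 1 0 0 (R.e0 h (ext_cc ha _ _)) (by simpa using hp)
  refine ⟨fun k h hk => ?_, fun k h hk => ?_, fun k h hk => ?_⟩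
  · exact (key 0 (k - i) k (by omega)).1 h (by simp [hx])
  · by_cases hki : k = i
    · exact (key 0 0 k (by omega)).2.1 h (by simp [hx])
    · exact (key (k - i - 1) 1 k (by omega)).2.1 h (by simp [hx])
  · exact (key (k - i) 0 k (by omega)).2.2 h (by simp [hx])

theorem later2 (ha : f .a = 0) (x : GV n m ⊕ QV' N) (i : ℕ) (hi : i ≤ N)
    (h : (GphiQ Cl N).Adj x (cc n m i hi)) (hp : 1 = pot N (cc n m i hi) - pot N x)
    (hx : ext N f x = 2) : Later Cl N f x i := by
  have key := fromTo (Cl := Cl) ha x i hi 1 1 0 0 (R.e0 h (ext_cc ha _ _)) (by simpa using hp)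
  refine ⟨fun k h hk => ?_, fun k h hk => ?_, fun k h hk => ?_⟩
  · exact (key (k - i) 0 k (by omega)).1 h (by simp [hx])
  · exact (key 0 (k - i) k (by omega)).2.1 h (by simp [hx])
  · by_cases hki : k = i
    · exact (key 0 0 k (by omega)).2.2 h (by simp [hx])
    · exact (key 1 (k - i - 1) k (by omega)).2.2 h (by simp [hx])

theorem laterG (pr : ∀ {u v}, (Gphi Cl).Adj u v → f u ≠ f v)
    (ha : f .a = 0) (hb : f .b = 1) (hc : f .c = 1)
    (hcl : ∀ j, f (.cla j) = 1 ∧ f (.clb j) = 2 ∧ f (.cl j) = 0)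
    (hl : ∀ j, ∃ t, f (.lit (Cl j t).1 (Cl j t).2) = 2) (u : GV n m) :
    Later Cl N f (.inl u) 0 := by
  have one : ∀ u, (Gphi Cl).Adj u .a → lev u = 1 → Later Cl N f (.inl u) 0 := by
    intro u hu hlu
    have h1 := pr hu
    have h2 : f u = 1 ∨ f u = 2 := by omega
    rcases h2 with h2 | h2
    · exact later1 ha _ 0 (Nat.zero_le _) ((inl_adj Cl N).2 hu) (by simp only [pot, cc, hlu]; simp [lev]) h2
    · exact later2 ha _ 0 (Nat.zero_le _) ((inl_adj Cl N).2 hu) (by simp only [pot, cc, hlu]; simp [lev]) h2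
  cases u with
  | a => exact later0 ha 0 (Nat.zero_le _)
  | b => exact one _ (by simp [Gphi]) rfl
  | c => exact one _ (by simp [Gphi]) rfl
  | d => exact one _ (by simp [Gphi]) rfl
  | lit y s => exact one _ (by simp [Gphi]) rfl
  | cla j => exact one _ (by simp [Gphi]) rfl
  | clb j =>
    have hx : ext N f (.inl (.clb j)) = 2 := (hcl j).2.1
    have r : R Cl N (ext N f) (.inl (.clb j)) (cc n m 0 (Nat.zero_le _)) 2 1 1 0 :=
      (R.e1 (y := .inl .b) ((inl_adj Cl N).2 (by simp [Gphi])) hb).trans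
        (R.e0 ((inl_adj Cl N).2 (by simp [Gphi])) ha)
    have key := fromTo (Cl := Cl) ha _ 0 (Nat.zero_le _) 2 1 1 0 r (by simp [pot, cc, lev])
    refine ⟨fun k h hk => ?_, fun k h hk => ?_, fun k h hk => ?_⟩
    · exact (key 0 k k (by omega)).1 h (by simp [hx])
    · exact (key k 0 k (by omega)).2.1 h (by simp [hx])
    · exact (key 0 k k (by omega)).2.2 h (by simp [hx])
  | cl j =>
    have hx : ext N f (.inl (.cl j)) = 0 := (hcl j).2.2
    obtain ⟨t, ht⟩ := hl j
    have r : R Cl N (ext N f) (.inl (.cl j)) (cc n m 0 (Nat.zero_le _)) 2 1 1 0 :=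
      (R.e1 (y := .inl .c) ((inl_adj Cl N).2 (by simp [Gphi])) hc).trans
        (R.e0 ((inl_adj Cl N).2 (by simp [Gphi])) ha)
    have r' : R Cl N (ext N f) (.inl (.cl j)) (cc n m 0 (Nat.zero_le _)) 2 1 0 1 :=
      (R.e2 (y := .inl (.lit (Cl j t).1 (Cl j t).2))
        ((inl_adj Cl N).2 ((adj_cl Cl _ j).2 (Or.inr (Or.inr (Or.inr ⟨t, rfl⟩))))) ht).trans
        (R.e0 ((inl_adj Cl N).2 (by simp [Gphi])) ha)
    have key := fromTo (Cl := Cl) ha _ 0 (Nat.zero_le _) 2 1 1 0 r (by simp [pot, cc, lev])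
    have key' := fromTo (Cl := Cl) ha _ 0 (Nat.zero_le _) 2 1 0 1 r' (by simp [pot, cc, lev])
    refine ⟨fun k h hk => ?_, fun k h hk => ?_, fun k h hk => ?_⟩
    · exact (key 0 k k (by omega)).1 h (by simp [hx])
    · exact (key' 0 k k (by omega)).2.1 h (by simp [hx])
    · exact (key k 0 k (by omega)).2.2 h (by simp [hx])

theorem goodQ (ha : f .a = 0) (x y : QV' N) (hxy : x ≠ y) :
    Good Cl N (ext N f) (.inr x) (.inr y) := by
  have LA : ∀ i (h : i < N), Later Cl N f (.inr (.A ⟨i, h⟩)) (i + 1) := fun i h =>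
    later1 ha _ (i + 1) h (adj_Ac h) (by rw [pot_cc, potA]; push_cast; omega) rfl
  have LB : ∀ i (h : i < N), Later Cl N f (.inr (.B ⟨i, h⟩)) (i + 1) := fun i h =>
    later2 ha _ (i + 1) h (adj_Bc h) (by rw [pot_cc, potB]; push_cast; omega) rfl
  have LC : ∀ i (h : i < N), Later Cl N f (.inr (.C ⟨i, h⟩)) (i + 1) := fun i h =>
    later0 ha (i + 1) h
  have AB : ∀ i (h : i < N), Good Cl N (ext N f) (.inr (.A ⟨i, h⟩)) (.inr (.B ⟨i, h⟩)) :=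
    fun i h => good_adj (by simp [GphiQ]) (by simp [ext])
  have AC : ∀ i (h : i < N), Good Cl N (ext N f) (.inr (.A ⟨i, h⟩)) (.inr (.C ⟨i, h⟩)) :=
    fun i h => good_adj (by simp [GphiQ]) (by simp [ext])
  have BC : ∀ i (h : i < N), Good Cl N (ext N f) (.inr (.B ⟨i, h⟩)) (.inr (.C ⟨i, h⟩)) :=
    fun i h => good_adj (by simp [GphiQ]) (by simp [ext])
  rcases x with ⟨i, hi⟩ | ⟨i, hi⟩ | ⟨i, hi⟩ <;> rcases y with ⟨k, hk⟩ | ⟨k, hk⟩ | ⟨k, hk⟩ <;>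
    rcases lt_trichotomy i k with h | rfl | h
  · exact (LA i hi).2.1 k hk h
  · exact absurd rfl hxy
  · exact ((LA k hk).2.1 i hi h).symm
  · exact (LA i hi).2.2 k hk h
  · exact AB _ _
  · exact ((LB k hk).2.1 i hi h).symm
  · exact (LA i hi).1 (k + 1) hk (by omega)
  · exact AC _ _
  · exact ((LC k hk).2.1 i hi h).symm
  · exact (LB i hi).2.1 k hk h
  · exact (AB _ _).symm
  · exact ((LA k hk).2.2 i hi h).symm
  · exact (LB i hi).2.2 k hk h
  · exact absurd rfl hxy
  · exact ((LB k hk).2.2 i hi h).symm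
  · exact (LB i hi).1 (k + 1) hk (by omega)
  · exact BC _ _
  · exact ((LC k hk).2.2 i hi h).symm
  · exact (LC i hi).2.1 k hk h
  · exact (AC _ _).symm
  · exact ((LA k hk).1 (i + 1) hi (by omega)).symm
  · exact (LC i hi).2.2 k hk h
  · exact (BC _ _).symm
  · exact ((LB k hk).1 (i + 1) hi (by omega)).symm
  · exact (LC i hi).1 (k + 1) hk (by omega)
  · exact absurd rfl hxy
  · exact ((LC k hk).1 (i + 1) hi (by omega)).symm

/-- The retraction onto `G(φ)`. -/
def ret : GV n m ⊕ QV' N → GV n m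
  | .inl u => u
  | .inr _ => .a

theorem retr {x y : GV n m ⊕ QV' N} (p : (GphiQ Cl N).Walk x y) (u v : GV n m)
    (hx : ret x = u) (hy : y = .inl v) :
    ∃ q : (Gphi Cl).Walk u v, q.length < p.length ∨
      (q.length = p.length ∧ q.support.map Sum.inl = p.support) := by
  induction p generalizing u with
  | nil => subst hy; subst hx; exact ⟨Walk.nil, Or.inr (by simp [ret])⟩
  | @cons x w z h p ih =>
    rcases x with x | x <;> rcases w with w | w
    · obtain rfl : x = u := hx
      obtain ⟨q, hq⟩ := ih w rfl hy
      refine ⟨Walk.cons ((inl_adj Cl N).1 h) q, ?_⟩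
      rcases hq with hq | ⟨hq, hs⟩
      · left; simpa using hq
      · right; exact ⟨by simpa using hq, by simp [hs]⟩
    · obtain rfl : x = u := hx
      obtain ⟨rfl, -⟩ := inl_inr_adj Cl N h
      obtain ⟨q, hq⟩ := ih .a rfl hy
      refine ⟨q, Or.inl ?_⟩
      rw [SimpleGraph.Walk.length_cons]
      rcases hq with hq | ⟨hq, hs⟩ <;> omega
    · obtain rfl : .a = u := hx
      obtain ⟨rfl, -⟩ := inl_inr_adj Cl N h.symm
      obtain ⟨q, hq⟩ := ih .a rfl hy
      refine ⟨q, Or.inl ?_⟩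
      rw [SimpleGraph.Walk.length_cons]
      rcases hq with hq | ⟨hq, hs⟩ <;> omega
    · obtain rfl : .a = u := hx
      obtain ⟨q, hq⟩ := ih .a rfl hy
      refine ⟨q, Or.inl ?_⟩
      rw [SimpleGraph.Walk.length_cons]
      rcases hq with hq | ⟨hq, hs⟩ <;> omega

/-- The inclusion of `G(φ)`. -/
def inc (Cl : Fin m → Fin 3 → Fin n × Bool) (N : ℕ) : Gphi Cl →g GphiQ Cl N :=
  ⟨Sum.inl, fun h => (inl_adj Cl N).2 h⟩

theorem incW (N : ℕ) {u v : GV n m} (p : (Gphi Cl).Walk u v) :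
    ∃ q : (GphiQ Cl N).Walk (.inl u) (.inl v), q.length = p.length ∧
      q.support = p.support.map Sum.inl :=
  ⟨p.map (inc Cl N), SimpleGraph.Walk.length_map _ _, SimpleGraph.Walk.support_map _ _⟩

theorem ga (u : GV n m) : ∃ p : (Gphi Cl).Walk u .a, p.length ≤ 2 := by
  have one : ∀ u, (Gphi Cl).Adj u .a → ∃ p : (Gphi Cl).Walk u .a, p.length ≤ 2 :=
    fun u h => ⟨Walk.cons h Walk.nil, by simp⟩
  have two : ∀ u v, (Gphi Cl).Adj u v → (Gphi Cl).Adj v .a →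
      ∃ p : (Gphi Cl).Walk u .a, p.length ≤ 2 :=
    fun u v h h' => ⟨Walk.cons h (Walk.cons h' Walk.nil), by simp⟩
  cases u with
  | a => exact ⟨Walk.nil, by simp⟩
  | b => exact one _ (by simp [Gphi])
  | c => exact one _ (by simp [Gphi])
  | d => exact one _ (by simp [Gphi])
  | lit y s => exact one _ (by simp [Gphi])
  | cla j => exact one _ (by simp [Gphi])
  | clb j => exact two _ .b (by simp [Gphi]) (by simp [Gphi])
  | cl j => exact two _ .c (by simp [Gphi]) (by simp [Gphi])

theorem dist_inl (u v : GV n m) :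
    (GphiQ Cl N).dist (.inl u) (.inl v) = (Gphi Cl).dist u v := by
  obtain ⟨pu, -⟩ := ga (Cl := Cl) u
  obtain ⟨pv, -⟩ := ga (Cl := Cl) v
  obtain ⟨q, hq⟩ := SimpleGraph.Reachable.exists_walk_length_eq_dist ⟨pu.append pv.reverse⟩
  obtain ⟨q', hq', -⟩ := incW N q
  have h1 := SimpleGraph.dist_le q'
  obtain ⟨p, hp⟩ := SimpleGraph.Reachable.exists_walk_length_eq_dist ⟨q'⟩
  obtain ⟨r, hr⟩ := retr p u v rfl rfl
  have h2 := SimpleGraph.dist_le r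
  omega

theorem backward (F : GV n m ⊕ QV' N → Fin 3) (hF : IsSCFVC (GphiQ Cl N) F) :
    IsSCFVC (Gphi Cl) (fun u => F (.inl u)) := by
  intro u v huv
  obtain ⟨p, hp, c, hc⟩ := hF (.inl u) (.inl v) (by simpa using huv)
  obtain ⟨q, hq⟩ := retr p u v rfl rfl
  have h2 : (Gphi Cl).dist u v ≤ q.length := SimpleGraph.dist_le q
  rw [dist_inl] at hp
  rcases hq with hq | ⟨hq, hs⟩
  · omega
  · refine ⟨q, hq.trans hp, c, ?_⟩
    rw [← hs, List.map_map] at hc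
    exact hc

theorem forward0 (hn : 4 ≤ n) (hf : IsSCFVC (Gphi Cl) f)
    (ha : f .a = 0) (hb : f .b = 1) (hd : f .d = 2) : IsSCFVC (GphiQ Cl N) (ext N f) := by
  obtain ⟨hc, hcl, hl⟩ := normal Cl hn hf ha hb hd
  have L := laterG (N := N) (fun h => proper hf h) ha hb hc hcl hl
  have L' : ∀ u q, Good Cl N (ext N f) (.inl u) (.inr q) := by
    rintro u (⟨k, hk⟩ | ⟨k, hk⟩ | ⟨k, hk⟩)
    · exact (L u).2.1 k hk (Nat.zero_le _)
    · exact (L u).2.2 k hk (Nat.zero_le _)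
    · exact (L u).1 (k + 1) hk (Nat.succ_pos _)
  rintro (u | u) (v | v) huv
  · obtain ⟨p, hp, c, hc⟩ := hf u v (by simpa using huv)
    obtain ⟨q, hq, hs⟩ := incW N p
    refine ⟨q, ?_, c, ?_⟩
    · rw [hq, hp, dist_inl]
    · rw [hs, List.map_map]; exact hc
  · exact L' u v
  · exact (L' v u).symm
  · exact goodQ ha u v (by simpa using huv)

theorem perm3 : ∀ x y z : Fin 3, x ≠ y → x ≠ z → y ≠ z →
    ∃ σ : Equiv.Perm (Fin 3), σ x = 0 ∧ σ y = 1 ∧ σ z = 2 := by decide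

theorem forward (hn : 4 ≤ n) (hf : IsSCFVC (Gphi Cl) f) :
    ∃ F : GV n m ⊕ QV' N → Fin 3, IsSCFVC (GphiQ Cl N) F := by
  obtain ⟨σ, h0, h1, h2⟩ := perm3 (f .a) (f .b) (f .d) (proper hf (by simp [Gphi]))
    (proper hf (by simp [Gphi])) (proper hf (by simp [Gphi]))
  refine ⟨ext N (fun u => σ (f u)), forward0 hn ?_ h0 h1 h2⟩
  intro u v huv
  obtain ⟨p, hp, c, hc⟩ := hf u v huv
  refine ⟨p, hp, σ c, ?_⟩
  have : p.support.map (fun u => σ (f u)) = (p.support.map f).map σ := by simp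
  rw [this, List.count_map_of_injective _ _ σ.injective, hc]

theorem walk_cc (i k : ℕ) (hik : i ≤ k) (hk : k ≤ N) :
    ∃ p : (GphiQ Cl N).Walk (cc n m i (hik.trans hk)) (cc n m k hk), p.length = 2 * (k - i) := by
  obtain ⟨p, hp, -⟩ := ladder (Cl := Cl) (f := fun _ => 0) rfl i (k - i) 0 k (by omega) hk
  exact ⟨p, by simpa using hp⟩

theorem walksQ (x : QV' N) : ∃ (p : (GphiQ Cl N).Walk (cc n m 0 (Nat.zero_le _)) (.inr x))
    (q : (GphiQ Cl N).Walk (.inr x) (cc n m N le_rfl)), p.length + q.length = 2 * N := by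
  rcases x with ⟨i, hi⟩ | ⟨i, hi⟩ | ⟨i, hi⟩
  · obtain ⟨p, hp⟩ := walk_cc (Cl := Cl) 0 i (Nat.zero_le _) hi.le
    obtain ⟨q, hq⟩ := walk_cc (Cl := Cl) (i + 1) N hi le_rfl
    refine ⟨p.append (Walk.cons (adj_cA hi) Walk.nil), Walk.cons (adj_Ac hi) q, ?_⟩
    simp; omega
  · obtain ⟨p, hp⟩ := walk_cc (Cl := Cl) 0 i (Nat.zero_le _) hi.le
    obtain ⟨q, hq⟩ := walk_cc (Cl := Cl) (i + 1) N hi le_rfl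
    refine ⟨p.append (Walk.cons (adj_cB hi) Walk.nil), Walk.cons (adj_Bc hi) q, ?_⟩
    simp; omega
  · obtain ⟨p, hp⟩ := walk_cc (Cl := Cl) 0 (i + 1) (Nat.zero_le _) hi
    obtain ⟨q, hq⟩ := walk_cc (Cl := Cl) (i + 1) N hi le_rfl
    refine ⟨p, q, (congrArg₂ _ hp hq).trans ?_⟩
    omega

theorem bounded (hN : 1 ≤ N) (x y : GV n m ⊕ QV' N) :
    ∃ p : (GphiQ Cl N).Walk x y, p.length ≤ 2 * N + 2 := by
  have gg : ∀ u, ∃ p : (GphiQ Cl N).Walk (.inl u) (cc n m 0 (Nat.zero_le _)), p.length ≤ 2 := by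
    intro u
    obtain ⟨p, hp⟩ := ga (Cl := Cl) u
    obtain ⟨q, hq, -⟩ := incW N p
    exact ⟨q, hq.trans_le hp⟩
  rcases x with x | x <;> rcases y with y | y
  · obtain ⟨p, hp⟩ := gg x
    obtain ⟨q, hq⟩ := gg y
    exact ⟨p.append q.reverse, by simp; omega⟩
  · obtain ⟨p, hp⟩ := gg x
    obtain ⟨q, r, hq⟩ := walksQ (Cl := Cl) y
    exact ⟨p.append q, by simp; omega⟩
  · obtain ⟨p, hp⟩ := gg y
    obtain ⟨q, r, hq⟩ := walksQ (Cl := Cl) x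
    exact ⟨(p.append q).reverse, by simp; omega⟩
  · obtain ⟨p, p', hp⟩ := walksQ (Cl := Cl) x
    obtain ⟨q, q', hq⟩ := walksQ (Cl := Cl) y
    by_cases h : p.length + q.length ≤ 2 * N
    · exact ⟨p.reverse.append q, by simp; omega⟩
    · exact ⟨p'.append q'.reverse, by simp; omega⟩

theorem diamQ (hm : 2 ≤ m) (hN : 1 ≤ N) : (GphiQ Cl N).diam = 2 * N + 2 := by
  have hle : (GphiQ Cl N).ediam ≤ ((2 * N + 2 : ℕ) : ℕ∞) := by
    apply SimpleGraph.ediam_le_of_edist_le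
    intro x y
    obtain ⟨p, hp⟩ := bounded (Cl := Cl) hN x y
    exact (SimpleGraph.edist_le p).trans (by exact_mod_cast hp)
  apply le_antisymm
  · exact ENat.toNat_le_of_le_natCast hle
  · have hne : (GphiQ Cl N).ediam ≠ ⊤ := ne_top_of_le_ne_top (ENat.natCast_ne_top _) hle
    refine le_trans ?_ (SimpleGraph.dist_le_diam hne (u := .inl (.cl ⟨0, by omega⟩))
      (v := cc n m N le_rfl))
    obtain ⟨p, -⟩ := bounded (Cl := Cl) hN (.inl (.cl ⟨0, by omega⟩)) (cc n m N le_rfl)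
    obtain ⟨q, hq⟩ := SimpleGraph.Reachable.exists_walk_length_eq_dist ⟨p⟩
    have h1 := pot_walk Cl N q
    rw [pot_cc, hq] at h1
    simp only [pot, lev] at h1
    omega

end Main

/-- Let `φ` be a 3-CNF formula with `m ≥ 2` clauses over `n ≥ 4` variables, each clause on
three pairwise distinct variables, every variable occurring in some clause. For even
`d ≥ 4`, the graph `G'` obtained from `G(φ)` and `Q_{(d-2)/2}` by identifying `c_0` with
the special vertex `a` has diameter exactly `d`, and `G(φ)` admits a strong conflict-free
vertex-connection `3`-coloring iff `G'` does. -/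
theorem stmt14 {n m : ℕ} (hm : 2 ≤ m) (hn : 4 ≤ n)
    (Cl : Fin m → Fin 3 → Fin n × Bool)
    (hdistinct : ∀ j, ∀ t t' : Fin 3, t ≠ t' → (Cl j t).1 ≠ (Cl j t').1)
    (hoccur : ∀ x : Fin n, ∃ j t, (Cl j t).1 = x)
    (d : ℕ) (hd : 4 ≤ d) (heven : Even d) :
    (GphiQ Cl ((d - 2) / 2)).diam = d ∧
    ((∃ f : GV n m → Fin 3, IsSCFVC (Gphi Cl) f) ↔
      ∃ f : GV n m ⊕ QV' ((d - 2) / 2) → Fin 3, IsSCFVC (GphiQ Cl ((d - 2) / 2)) f) := by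
  obtain ⟨r, rfl⟩ := heven
  have hN : 1 ≤ (r + r - 2) / 2 := by omega
  refine ⟨?_, ?_, ?_⟩
  · rw [diamQ hm hN]; omega
  · rintro ⟨f, hf⟩
    exact forward hn hf
  · rintro ⟨F, hF⟩
    exact ⟨_, backward F hF⟩
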